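/- The class of finite simple graphs in which any two induced cycles have the same parity is χ-bounded: there exists a function f : ℕ → ℕ such that every finite simple graph G in which all induced cycles have lengths of the same parity satisfies χ(G) ≤ f(ω(G)). -/

import Mathlib

open SimpleGraph

/-- The chromatic number of a graph, as a natural number. -/
noncomputable def chi {V : Type*} (G : SimpleGraph V) : ℕ :=
  sInf {n | G.Colorable n}

/-- The independence (stability) number of a graph. -/
noncomputable def indepNum {V : Type*} (G : SimpleGraph V) : ℕ :=
  sSup {n | ∃ s : Finset V, s.card = n ∧ ∀ a ∈ s, ∀ b ∈ s, ¬ G.Adj a b}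

/-- A graph is perfect if every induced subgraph has chromatic number equal to
its clique number. -/
def IsPerfect {V : Type*} (G : SimpleGraph V) : Prop :=
  ∀ s : Set V, chi (G.induce s) = (G.induce s).cliqueNum

/-- A graph is nice if every induced subgraph `H` satisfies `χ(H) - ω(H) ∈ {0, 1}`. -/
def IsNice {V : Type*} (G : SimpleGraph V) : Prop :=
  ∀ s : Set V, chi (G.induce s) = (G.induce s).cliqueNum ∨
    chi (G.induce s) = (G.induce s).cliqueNum + 1

/-- The perfect chromatic number: the smallest `k` such that the vertex set can be
partitioned into `k` perfect sets. -/
noncomputable def chiP {V : Type*} (G : SimpleGraph V) : ℕ :=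
  sInf {k | ∃ f : V → Fin k, ∀ i, IsPerfect (G.induce (f ⁻¹' {i}))}

namespace SimpleGraph

/-- `G` has a proper colouring of the vertices in `S` with the colours `0, …, n - 1`. -/
def ColorableOn {V : Type*} (G : SimpleGraph V) (S : Set V) (n : ℕ) : Prop :=
  ∃ f : V → ℕ, (∀ v ∈ S, f v < n) ∧ ∀ u ∈ S, ∀ v ∈ S, G.Adj u v → f u ≠ f v

/-- Any two vertices of `S` are joined by a walk inside `S`. -/
def ConnOn {V : Type*} (G : SimpleGraph V) (S : Set V) : Prop :=
  ∀ u ∈ S, ∀ v ∈ S, Relation.ReflTransGen (fun x y => G.Adj x y ∧ x ∈ S ∧ y ∈ S) u v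

/-- `A` and `B` are disjoint and there is no edge between them. -/
def Anticomplete {V : Type*} (G : SimpleGraph V) (A B : Set V) : Prop :=
  ∀ a ∈ A, ∀ b ∈ B, a ≠ b ∧ ¬ G.Adj a b

/-- The ball of radius two around `v`. -/
def ballTwo {V : Type*} (G : SimpleGraph V) (v : V) : Set V :=
  {y | ∃ z, (z = v ∨ G.Adj v z) ∧ (y = z ∨ G.Adj z y)}

/-- `p 0, …, p n` are the vertices of an induced path, in order. -/
def IsIndPath {V : Type*} (G : SimpleGraph V) (p : ℕ → V) (n : ℕ) : Prop :=
  ∀ i j, i < j → j ≤ n → p i ≠ p j ∧ (G.Adj (p i) (p j) ↔ j = i + 1)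

/-- `c 0, …, c (l - 1)` are the vertices of an induced cycle, in cyclic order. -/
def IsIndCycle {V : Type*} (G : SimpleGraph V) (c : ℕ → V) (l : ℕ) : Prop :=
  ∀ i j, i < j → j < l → c i ≠ c j ∧ (G.Adj (c i) (c j) ↔ j = i + 1 ∨ i = 0 ∧ j + 1 = l)

/-- Every induced cycle of length at least four is odd. -/
def EvenHoleFree {V : Type*} (G : SimpleGraph V) : Prop :=
  ∀ c l, 4 ≤ l → G.IsIndCycle c l → Odd l

variable {V : Type*} {G : SimpleGraph V}

section Coloring

lemma ColorableOn.mono {S T : Set V} {m n : ℕ} (h : G.ColorableOn T m) (hS : S ⊆ T)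
    (hmn : m ≤ n) : G.ColorableOn S n := by
  obtain ⟨f, hf, hf'⟩ := h
  exact ⟨f, fun v hv => (hf v (hS hv)).trans_le hmn, fun u hu v hv => hf' u (hS hu) v (hS hv)⟩

lemma ColorableOn.glue {ι : Type*} {S : Set V} {n : ℕ} (r : V → ι)
    (hr : ∀ u ∈ S, ∀ v ∈ S, G.Adj u v → r u = r v)
    (h : ∀ i, G.ColorableOn {v | v ∈ S ∧ r v = i} n) : G.ColorableOn S n := by
  choose f hf hf' using h
  refine ⟨fun v => f (r v) v, fun v hv => hf _ v ⟨hv, rfl⟩, fun u hu v hv huv => ?_⟩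
  have e := hr u hu v hv huv
  simp only [e]
  exact hf' (r v) u ⟨hu, e⟩ v ⟨hv, rfl⟩ huv

lemma ColorableOn.mul {S : Set V} {k n : ℕ} (r : V → ℕ) (hr : ∀ v ∈ S, r v < k)
    (h : ∀ i, G.ColorableOn {v | v ∈ S ∧ r v = i} n) : G.ColorableOn S (k * n) := by
  choose f hf hf' using h
  have key : ∀ v ∈ S, f (r v) v < n := fun v hv => hf _ v ⟨hv, rfl⟩
  refine ⟨fun v => f (r v) v + n * r v, fun v hv => ?_, fun u hu v hv huv e => ?_⟩
  · have h1 := key v hv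
    have h2 := Nat.mul_le_mul_left n (Nat.succ_le_of_lt (hr v hv))
    rw [Nat.mul_comm k n]
    rw [Nat.mul_succ] at h2
    simp only
    omega
  · have hu' := key u hu
    have hv' := key v hv
    have hn : 0 < n := by omega
    have e1 := congrArg (· / n) e
    simp only [Nat.add_mul_div_left _ _ hn, Nat.div_eq_of_lt hu', Nat.div_eq_of_lt hv',
      Nat.zero_add] at e1
    have e2 : f (r u) u = f (r v) v := by
      simp only [e1] at e ⊢
      omega
    rw [e1] at e2
    exact hf' (r v) u ⟨hu, e1⟩ v ⟨hv, rfl⟩ huv e2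

lemma ColorableOn.union {S T : Set V} {m n : ℕ} (hS : G.ColorableOn S m)
    (hT : G.ColorableOn T n) : G.ColorableOn (S ∪ T) (m + n) := by
  classical
  obtain ⟨f, hf, hf'⟩ := hS
  obtain ⟨g, hg, hg'⟩ := hT
  refine ⟨fun v => if v ∈ S then f v else m + g v, ?_, ?_⟩
  · rintro v hv
    by_cases h : v ∈ S
    · simpa [h] using Nat.lt_add_right n (hf v h)
    · simpa [h] using hg v (hv.resolve_left h)
  · intro u hu v hv huv
    have h1 := hf u
    have h2 := hf v
    by_cases h : u ∈ S <;> by_cases h' : v ∈ S <;> simp only [h, h', if_true, if_false]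
    · exact hf' u h v h' huv
    · have := h1 h
      omega
    · have := h2 h'
      omega
    · have := hg' u (hu.resolve_left h) v (hv.resolve_left h') huv
      omega

lemma colorableOn_of_forall_not_adj {S : Set V} (h : ∀ u ∈ S, ∀ v ∈ S, ¬ G.Adj u v) :
    G.ColorableOn S 1 :=
  ⟨fun _ => 0, fun _ _ => Nat.one_pos, fun u hu v hv huv => (h u hu v hv huv).elim⟩

lemma colorableOn_exists_mem_list {n : ℕ} {B : V → Set V} (hB : ∀ t, G.ColorableOn (B t) n)
    (L : List V) : G.ColorableOn {v | ∃ t ∈ L, v ∈ B t} (L.length * n) := by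
  induction L with
  | nil => exact ⟨fun _ => 0, by simp, by simp⟩
  | cons t L ih =>
    refine ((hB t).union ih).mono ?_ (by simp [Nat.succ_mul, Nat.add_comm])
    rintro v ⟨s, hs, hv⟩
    rcases List.mem_cons.1 hs with rfl | hs
    · exact Or.inl hv
    · exact Or.inr ⟨s, hs, hv⟩

lemma exists_mem_forall_notMem_of_not_colorableOn {n k : ℕ} {S : Set V} {B : V → Set V}
    (hB : ∀ t, G.ColorableOn (B t) n) (L : List V) (hL : L.length ≤ k)
    (hS : ¬ G.ColorableOn S (k * n)) : ∃ x ∈ S, ∀ t ∈ L, x ∉ B t := by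
  by_contra! h
  exact hS ((colorableOn_exists_mem_list hB L).mono h (Nat.mul_le_mul_right n hL))

lemma exists_connOn_not_colorableOn {S : Set V} {n : ℕ} (h : ¬ G.ColorableOn S n) :
    ∃ D ⊆ S, G.ConnOn D ∧ ¬ G.ColorableOn D n := by
  by_contra! H
  let R : V → V → Prop := fun x y => G.Adj x y ∧ x ∈ S ∧ y ∈ S
  have hsymm : ∀ x y, R x y → R y x := fun x y hxy => ⟨hxy.1.symm, hxy.2.2, hxy.2.1⟩
  have hsymm' : ∀ x y, Relation.ReflTransGen R x y → Relation.ReflTransGen R y x := by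
    intro x y hxy
    induction hxy with
    | refl => exact .refl
    | tail _ h2 ih => exact .head (hsymm _ _ h2) ih
  refine h (ColorableOn.glue (fun v => {u | Relation.ReflTransGen R v u}) ?_ fun C => ?_)
  · intro u hu v hv huv
    ext w
    exact ⟨fun hw => .head ⟨huv.symm, hv, hu⟩ hw, fun hw => .head ⟨huv, hu, hv⟩ hw⟩
  · refine H _ (fun v hv => hv.1) fun u hu v hv => ?_
    have huv : Relation.ReflTransGen R u v := by
      have : v ∈ {w | Relation.ReflTransGen R v w} := Relation.ReflTransGen.refl
      rw [hv.2, ← hu.2] at this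
      exact this
    clear hv
    induction huv with
    | refl => exact .refl
    | @tail b c hb hbc ih =>
      have key : ∀ w ∈ S, Relation.ReflTransGen R u w →
          w ∈ {v | v ∈ S ∧ {u | Relation.ReflTransGen R v u} = C} := by
        intro w hw huw
        refine ⟨hw, ?_⟩
        rw [← hu.2]
        ext z
        exact ⟨fun hz => huw.trans hz, fun hz => (hsymm' _ _ huw).trans hz⟩
      exact .tail ih ⟨hbc.1, key b hbc.2.1 hb, key c hbc.2.2 (hb.tail hbc)⟩

end Coloring

section Layers

/-- A set that needs more than `2 * n` colours contains a breadth-first layering whose last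
relevant layer `D` is connected and needs more than `n` colours: `B` dominates `D`, and `B` is
attached to a connected set `U` that sees nothing of `D`. -/
lemma exists_layering {S : Set V} {n : ℕ} (hball : ∀ v, G.ColorableOn (G.ballTwo v) n)
    (hS : ¬ G.ColorableOn S (2 * n)) :
    ∃ U B D : Set V, U ⊆ S ∧ B ⊆ S ∧ D ⊆ S ∧ G.ConnOn U ∧ G.ConnOn D ∧
      ¬ G.ColorableOn D n ∧ G.Anticomplete U D ∧ Disjoint B D ∧
      (∀ x ∈ D, ∃ b ∈ B, G.Adj x b) ∧ (∀ b ∈ B, ∃ u ∈ U, G.Adj b u) := by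
  classical
  obtain ⟨C, hCS, hC, hCn⟩ := exists_connOn_not_colorableOn hS
  have hne : C.Nonempty := by
    rw [Set.nonempty_iff_ne_empty]
    rintro rfl
    exact hCn ⟨fun _ => 0, by simp, by simp⟩
  obtain ⟨z, hz⟩ := hne
  let Rch : ℕ → V → Prop := fun k => Nat.rec (fun v => v = z)
    (fun _ P v => v ∈ C ∧ (P v ∨ ∃ u, P u ∧ G.Adj u v)) k
  have hRC : ∀ k v, Rch k v → v ∈ C := by
    rintro (_ | k) v hv
    · have : v = z := hv
      exact this ▸ hz
    · exact hv.1
  have hex : ∀ v, ∃ k, v ∈ C → Rch k v := by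
    intro v
    by_cases hv : v ∈ C
    · have := hC z hz v hv
      clear hv
      induction this with
      | refl => exact ⟨0, fun _ => rfl⟩
      | @tail b c _ hbc ih =>
        obtain ⟨k, hk⟩ := ih
        exact ⟨k + 1, fun hc => ⟨hc, .inr ⟨b, hk hbc.2.1, hbc.1⟩⟩⟩
    · exact ⟨0, fun h => (hv h).elim⟩
  obtain ⟨d, hd, hdle⟩ : ∃ d : V → ℕ, (∀ v ∈ C, Rch (d v) v) ∧ ∀ v k, Rch k v → d v ≤ k :=
    ⟨fun v => @Nat.find _ (Classical.decPred _) (hex v),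
      fun v hv => @Nat.find_spec _ (Classical.decPred _) (hex v) hv,
      fun v k h => @Nat.find_min' _ (Classical.decPred _) (hex v) k fun _ => h⟩
  have hd0 : ∀ v ∈ C, d v = 0 → v = z := by
    intro v hv h0
    have := hd v hv
    rw [h0] at this
    exact this
  have hdadj : ∀ u ∈ C, ∀ v ∈ C, G.Adj u v → d v ≤ d u + 1 := fun u hu v hv huv =>
    hdle v _ ⟨hv, .inr ⟨u, hd u hu, huv⟩⟩
  have hdpred : ∀ v ∈ C, ∀ k, d v = k + 1 → ∃ u ∈ C, d u = k ∧ G.Adj u v := by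
    intro v hv k hk
    have h1 := hd v hv
    rw [hk] at h1
    rcases h1.2 with h2 | ⟨u, hu, huv⟩
    · have := hdle v k h2
      omega
    · have huC := hRC k u hu
      have h3 := hdle u k hu
      have h4 := hdadj u huC v hv huv
      exact ⟨u, huC, by omega, huv⟩
  have hlayer : ∃ j, ¬ G.ColorableOn {v | v ∈ C ∧ d v = j} n := by
    by_contra! H
    refine hCn (ColorableOn.mul (fun v => d v % 2) (fun v _ => Nat.mod_lt _ two_pos) fun i => ?_)
    refine ColorableOn.glue d ?_ fun j => (H j).mono (fun v hv => ⟨hv.1.1, hv.2⟩) le_rfl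
    rintro u ⟨hu, hu'⟩ v ⟨hv, hv'⟩ huv
    have h1 := hdadj u hu v hv huv
    have h2 := hdadj v hv u hu huv.symm
    omega
  obtain ⟨j, hj⟩ := hlayer
  have hj2 : 2 ≤ j := by
    by_contra hlt
    refine hj ((hball z).mono ?_ le_rfl)
    rintro v ⟨hv, hvj⟩
    obtain h0 | h1 : d v = 0 ∨ d v = 0 + 1 := by omega
    · exact ⟨z, .inl rfl, .inl (hd0 v hv h0)⟩
    · obtain ⟨u, hu, hu0, huv⟩ := hdpred v hv 0 h1
      rw [hd0 u hu hu0] at huv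
      exact ⟨z, .inl rfl, .inr huv⟩
  obtain ⟨i, rfl⟩ := Nat.exists_eq_add_of_le' hj2
  obtain ⟨D, hDj, hD, hDn⟩ := exists_connOn_not_colorableOn hj
  refine ⟨{v | v ∈ C ∧ d v ≤ i}, {v | v ∈ C ∧ d v = i + 1}, D, fun v hv => hCS hv.1,
    fun v hv => hCS hv.1, fun v hv => hCS (hDj hv).1, ?_, hD, hDn, ?_, ?_, ?_, ?_⟩
  · have hdz : d z = 0 := Nat.le_zero.1 (hdle z 0 rfl)
    have key : ∀ k ≤ i, ∀ v ∈ C, d v = k →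
        Relation.ReflTransGen (fun x y => G.Adj x y ∧ x ∈ {v | v ∈ C ∧ d v ≤ i} ∧
          y ∈ {v | v ∈ C ∧ d v ≤ i}) v z ∧
        Relation.ReflTransGen (fun x y => G.Adj x y ∧ x ∈ {v | v ∈ C ∧ d v ≤ i} ∧
          y ∈ {v | v ∈ C ∧ d v ≤ i}) z v := by
      intro k
      induction k with
      | zero =>
        intro _ v hv h0
        rw [hd0 v hv h0]
        exact ⟨.refl, .refl⟩
      | succ k ih =>
        intro hk v hv hvk
        obtain ⟨u, hu, huk, huv⟩ := hdpred v hv k hvk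
        obtain ⟨h1, h2⟩ := ih (by omega) u hu huk
        have hu' : u ∈ {v | v ∈ C ∧ d v ≤ i} := ⟨hu, by omega⟩
        have hv' : v ∈ {v | v ∈ C ∧ d v ≤ i} := ⟨hv, by omega⟩
        exact ⟨.head ⟨huv.symm, hv', hu'⟩ h1, .tail h2 ⟨huv, hu', hv'⟩⟩
    intro u hu v hv
    exact (key _ hu.2 u hu.1 rfl).1.trans (key _ hv.2 v hv.1 rfl).2
  · rintro u ⟨hu, hui⟩ v hv
    obtain ⟨hvC, hvi⟩ := hDj hv
    refine ⟨?_, fun huv => ?_⟩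
    · rintro rfl
      omega
    · have := hdadj u hu v hvC huv
      omega
  · rw [Set.disjoint_left]
    rintro v ⟨_, hv⟩ hvD
    have := (hDj hvD).2
    omega
  · intro x hx
    obtain ⟨hxC, hxi⟩ := hDj hx
    obtain ⟨u, hu, hui, hux⟩ := hdpred x hxC (i + 1) hxi
    exact ⟨u, ⟨hu, hui⟩, hux.symm⟩
  · rintro b ⟨hb, hbi⟩
    obtain ⟨u, hu, hui, hub⟩ := hdpred b hb i hbi
    exact ⟨u, ⟨hu, hui.le⟩, hub.symm⟩

end Layers

section Paths

lemma Anticomplete.symm {A B : Set V} (h : G.Anticomplete A B) : G.Anticomplete B A :=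
  fun b hb a ha => ⟨(h a ha b hb).1.symm, fun hab => (h a ha b hb).2 hab.symm⟩

lemma Anticomplete.mono {A B A' B' : Set V} (h : G.Anticomplete A B) (hA : A' ⊆ A)
    (hB : B' ⊆ B) : G.Anticomplete A' B' :=
  fun a ha b hb => h a (hA ha) b (hB hb)

lemma IsIndPath.snoc {p : ℕ → V} {n : ℕ} (hp : G.IsIndPath p n) {z : V}
    (hz : ∀ i ≤ n, p i ≠ z ∧ (G.Adj (p i) z ↔ i = n)) :
    G.IsIndPath (fun i => if i ≤ n then p i else z) (n + 1) := by
  intro i j hij hj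
  have hi : i ≤ n := by omega
  by_cases h : j ≤ n
  · simpa [hi, h] using hp i j hij h
  · obtain rfl : j = n + 1 := by omega
    have := hz i hi
    simp only [hi, h, if_true, if_false]
    refine ⟨this.1, this.2.trans ?_⟩
    omega

lemma IsIndPath.reverse {p : ℕ → V} {n : ℕ} (hp : G.IsIndPath p n) :
    G.IsIndPath (fun i => p (n - i)) n := by
  intro i j hij hj
  obtain ⟨h1, h2⟩ := hp (n - j) (n - i) (by omega) (by omega)
  refine ⟨h1.symm, ?_⟩
  rw [G.adj_comm, h2]
  omega

lemma ConnOn.exists_isIndPath {U : Set V} (hU : G.ConnOn U) {a b : V} (hne : a ≠ b)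
    (hadj : ¬ G.Adj a b) (ha : ∃ u ∈ U, G.Adj a u) (hb : ∃ u ∈ U, G.Adj b u) :
    ∃ (p : ℕ → V) (n : ℕ), 2 ≤ n ∧ G.IsIndPath p n ∧ p 0 = a ∧ p n = b ∧
      ∀ i, 0 < i → i < n → p i ∈ U := by
  classical
  obtain ⟨u, hu, hau⟩ := ha
  obtain ⟨v, hv, hbv⟩ := hb
  have hwalk : ∃ (m : ℕ) (p : ℕ → V), p 0 = a ∧ p (m + 1) = v ∧
      (∀ i < m + 1, G.Adj (p i) (p (i + 1))) ∧ ∀ i, 0 < i → i < m + 2 → p i ∈ U := by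
    have := hU u hu v hv
    clear hbv hv
    induction this with
    | refl =>
      refine ⟨0, fun i => if i = 0 then a else u, by simp, by simp, ?_, ?_⟩
      · intro i hi
        obtain rfl : i = 0 := by omega
        simpa using hau
      · intro i hi _
        simpa [hi.ne'] using hu
    | @tail x y _ hxy ih =>
      obtain ⟨m, p, h0, h1, h2, h3⟩ := ih
      refine ⟨m + 1, fun i => if i ≤ m + 1 then p i else y, by simpa using h0, by simp, ?_, ?_⟩
      · intro i hi
        by_cases h : i + 1 ≤ m + 1
        · simpa [h, show i ≤ m + 1 by omega] using h2 i (by omega)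
        · obtain rfl : i = m + 1 := by omega
          simpa [h1] using hxy.1
      · intro i hi hi'
        by_cases h : i ≤ m + 1
        · simpa [h] using h3 i hi (by omega)
        · simpa [h] using hxy.2.2
  have hex : ∃ n : ℕ, ∃ p : ℕ → V, p 0 = a ∧ p n = b ∧
      (∀ i < n, G.Adj (p i) (p (i + 1))) ∧ ∀ i, 0 < i → i < n → p i ∈ U := by
    obtain ⟨m, p, h0, h1, h2, h3⟩ := hwalk
    refine ⟨m + 2, fun i => if i ≤ m + 1 then p i else b, by simpa using h0, by simp, ?_, ?_⟩
    · intro i hi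
      by_cases h : i + 1 ≤ m + 1
      · simpa [h, show i ≤ m + 1 by omega] using h2 i (by omega)
      · obtain rfl : i = m + 1 := by omega
        simpa [h1] using hbv.symm
    · intro i hi hi'
      simpa [show i ≤ m + 1 by omega] using h3 i hi (by omega)
  obtain ⟨p, h0, h1, h2, h3⟩ := Nat.find_spec hex
  have hmin := fun {m} => @Nat.find_min _ _ hex m
  generalize Nat.find hex = n at *
  have hn0 : n ≠ 0 := by
    rintro rfl
    exact hne (h0.symm.trans h1)
  have hn1 : n ≠ 1 := by
    rintro rfl
    have := h2 0 one_pos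
    rw [h0, h1] at this
    exact hadj this
  refine ⟨p, n, by omega, fun i j hij hj => ⟨fun heq => ?_, fun hij' => ?_, ?_⟩, h0, h1, h3⟩
  · refine hmin (m := n - (j - i)) (by omega)
      ⟨fun k => if k ≤ i then p k else p (k + (j - i)), by simpa using h0, ?_, ?_, ?_⟩
    · by_cases h : n - (j - i) ≤ i
      · obtain rfl : j = n := by omega
        simpa [h, show j - (j - i) = i by omega] using heq.trans h1
      · simpa [h, show n - (j - i) + (j - i) = n by omega] using h1
    · intro k hk
      rcases lt_trichotomy k i with h | rfl | h
      · simpa [h.le, Nat.succ_le_of_lt h] using h2 k (by omega)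
      · have := h2 j (by omega)
        rw [← heq] at this
        simpa [show k + 1 + (j - k) = j + 1 by omega] using this
      · have := h2 (k + (j - i)) (by omega)
        simpa [show ¬ k ≤ i by omega, show ¬ k + 1 ≤ i by omega, Nat.add_right_comm] using this
    · intro k hk hk'
      by_cases h : k ≤ i
      · simpa [h] using h3 k hk (by omega)
      · simpa [h] using h3 (k + (j - i)) (by omega) (by omega)
  · by_contra hne'
    refine hmin (m := n - (j - i - 1)) (by omega)
      ⟨fun k => if k ≤ i then p k else p (k + (j - i - 1)), by simpa using h0, ?_, ?_, ?_⟩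
    · simpa [show ¬ n - (j - i - 1) ≤ i by omega,
        show n - (j - i - 1) + (j - i - 1) = n by omega] using h1
    · intro k hk
      rcases lt_trichotomy k i with h | rfl | h
      · simpa [h.le, Nat.succ_le_of_lt h] using h2 k (by omega)
      · simpa [show k + 1 + (j - k - 1) = j by omega] using hij'
      · have := h2 (k + (j - i - 1)) (by omega)
        simpa [show ¬ k ≤ i by omega, show ¬ k + 1 ≤ i by omega, Nat.add_right_comm] using this
    · intro k hk hk'
      by_cases h : k ≤ i
      · simpa [h] using h3 k hk (by omega)
      · simpa [h] using h3 (k + (j - i - 1)) (by omega) (by omega)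
  · rintro rfl
    exact h2 i (by omega)

end Paths

section Holes

lemma EvenHoleFree.odd_of_isIndPath (hG : G.EvenHoleFree) {p q : ℕ → V} {n m : ℕ}
    (hp : G.IsIndPath p n) (hq : G.IsIndPath q m) (hnm : 2 ≤ n + m)
    (hpq : ∀ i ≤ n, ∀ j ≤ m, p i ≠ q j ∧
      (G.Adj (p i) (q j) ↔ i = n ∧ j = 0 ∨ i = 0 ∧ j = m)) :
    Odd (n + m) := by
  have key : Odd (n + m + 2) := by
    refine hG (fun i => if i ≤ n then p i else q (i - n - 1)) _ (by omega) fun i j hij hj => ?_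
    by_cases hi : i ≤ n <;> by_cases hj' : j ≤ n <;> simp only [hi, hj', if_true, if_false]
    · obtain ⟨h1, h2⟩ := hp i j hij hj'
      exact ⟨h1, h2.trans (by omega)⟩
    · obtain ⟨h1, h2⟩ := hpq i hi (j - n - 1) (by omega)
      exact ⟨h1, h2.trans (by omega)⟩
    · omega
    · obtain ⟨h1, h2⟩ := hq (i - n - 1) (j - n - 1) (by omega) (by omega)
      exact ⟨h1, h2.trans (by omega)⟩
  rw [Nat.odd_iff] at key ⊢
  omega

/-- Two induced paths with common ends and anticomplete interiors form a hole. -/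
lemma EvenHoleFree.odd_add_of_common_ends (hG : G.EvenHoleFree) {p q : ℕ → V} {n m : ℕ}
    {X Y : Set V} (hXY : G.Anticomplete X Y)
    (hp : G.IsIndPath p n) (hq : G.IsIndPath q m) (hn : 2 ≤ n) (hm : 2 ≤ m)
    (h0 : p 0 = q 0) (h1 : p n = q m) (hpX : ∀ i, 0 < i → i < n → p i ∈ X)
    (hqY : ∀ i, 0 < i → i < m → q i ∈ Y) : Odd (n + m) := by
  have key : Odd (n + (m - 2)) := by
    refine hG.odd_of_isIndPath (q := fun j => q (m - 1 - j)) hp ?_ (by omega) ?_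
    · intro i j hij hj
      obtain ⟨h2, h3⟩ := hq (m - 1 - j) (m - 1 - i) (by omega) (by omega)
      refine ⟨h2.symm, ?_⟩
      rw [G.adj_comm, h3]
      omega
    · intro i hi j hj
      rcases Nat.eq_zero_or_pos i with rfl | hi0
      · obtain ⟨h2, h3⟩ := hq 0 (m - 1 - j) (by omega) (by omega)
        rw [h0]
        exact ⟨h2, h3.trans (by omega)⟩
      · rcases hi.lt_or_eq with hin | rfl
        · obtain ⟨h2, h3⟩ := hXY _ (hpX i hi0 hin) _ (hqY (m - 1 - j) (by omega) (by omega))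
          exact ⟨h2, iff_of_false h3 (by omega)⟩
        · obtain ⟨h2, h3⟩ := hq (m - 1 - j) m (by omega) (by omega)
          rw [h1, G.adj_comm]
          exact ⟨h2.symm, h3.trans (by omega)⟩
  rw [Nat.odd_iff] at key ⊢
  omega

/-- No theta: vertices attached to three pairwise anticomplete connected sets are pairwise
adjacent. -/
lemma EvenHoleFree.eq_or_adj_of_three (hG : G.EvenHoleFree) {X Y Z : Set V}
    (hXY : G.Anticomplete X Y) (hXZ : G.Anticomplete X Z) (hYZ : G.Anticomplete Y Z)
    (hX : G.ConnOn X) (hY : G.ConnOn Y) (hZ : G.ConnOn Z) {a b : V}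
    (haX : ∃ u ∈ X, G.Adj a u) (haY : ∃ u ∈ Y, G.Adj a u) (haZ : ∃ u ∈ Z, G.Adj a u)
    (hbX : ∃ u ∈ X, G.Adj b u) (hbY : ∃ u ∈ Y, G.Adj b u) (hbZ : ∃ u ∈ Z, G.Adj b u) :
    a = b ∨ G.Adj a b := by
  by_contra! h
  obtain ⟨p, n, hn, hp, hp0, hp1, hpX⟩ := hX.exists_isIndPath h.1 h.2 haX hbX
  obtain ⟨q, m, hm, hq, hq0, hq1, hqY⟩ := hY.exists_isIndPath h.1 h.2 haY hbY
  obtain ⟨r, k, hk, hr, hr0, hr1, hrZ⟩ := hZ.exists_isIndPath h.1 h.2 haZ hbZ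
  have e1 := hG.odd_add_of_common_ends hXY hp hq hn hm (hp0.trans hq0.symm)
    (hp1.trans hq1.symm) hpX hqY
  have e2 := hG.odd_add_of_common_ends hXZ hp hr hn hk (hp0.trans hr0.symm)
    (hp1.trans hr1.symm) hpX hrZ
  have e3 := hG.odd_add_of_common_ends hYZ hq hr hm hk (hq0.trans hr0.symm)
    (hq1.trans hr1.symm) hqY hrZ
  rw [Nat.odd_iff] at e1 e2 e3
  omega


lemma IsIndPath.exists_extend {p : ℕ → V} {n : ℕ} (hp : G.IsIndPath p n) {y z : V}
    (hz : ∀ i < n, p i ≠ z ∧ ¬ G.Adj (p i) z) (hy : ∀ i < n, p i ≠ y ∧ ¬ G.Adj (p i) y)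
    (hnz : p n ≠ z) (hny : G.Adj (p n) y) (hyz : G.Adj y z) :
    ∃ (P : ℕ → V) (k : ℕ), (k = n ∧ G.Adj (p n) z ∨ k = n + 1 ∧ ¬ G.Adj (p n) z) ∧
      G.IsIndPath P k ∧ (∀ i ≤ k, P i ≠ z ∧ (G.Adj (P i) z ↔ i = k)) ∧
      (∀ i ≤ n, P i = p i) ∧ ∀ i, n < i → P i = y := by
  have hPn : ∀ i ≤ n, (if i ≤ n then p i else y) = p i := fun i hi => if_pos hi
  have hPy : ∀ i, n < i → (if i ≤ n then p i else y) = y := fun i hi => if_neg hi.not_ge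
  have hsnoc : G.IsIndPath (fun i => if i ≤ n then p i else y) (n + 1) := by
    refine hp.snoc fun i hi => ?_
    rcases hi.lt_or_eq with h | rfl
    · exact ⟨(hy i h).1, iff_of_false (hy i h).2 h.ne⟩
    · exact ⟨hny.ne, iff_of_true hny rfl⟩
  by_cases h : G.Adj (p n) z
  · refine ⟨_, n, .inl ⟨rfl, h⟩, fun i j hij hj => hsnoc i j hij (by omega), ?_, hPn, hPy⟩
    intro i hi
    rw [hPn i hi]
    rcases hi.lt_or_eq with hin | rfl
    · exact ⟨(hz i hin).1, iff_of_false (hz i hin).2 hin.ne⟩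
    · exact ⟨hnz, iff_of_true h rfl⟩
  · refine ⟨_, n + 1, .inr ⟨rfl, h⟩, hsnoc, ?_, hPn, hPy⟩
    intro i hi
    rcases Nat.lt_or_ge n i with hin | hin
    · simp only [hPy i hin]
      exact ⟨hyz.ne, iff_of_true hyz (by omega)⟩
    · simp only [hPn i hin]
      rcases hin.lt_or_eq with hin' | rfl
      · exact ⟨(hz i hin').1, iff_of_false (hz i hin').2 (by omega)⟩
      · exact ⟨hnz, iff_of_false h (by omega)⟩

open Classical in
/-- Two induced paths from `a` to `a'` and from `b` to `b'` with anticomplete interiors, whose ends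
are linked either by an edge or through the common neighbours `x` and `x'`, form a hole. -/
lemma EvenHoleFree.odd_of_linked (hG : G.EvenHoleFree) {p q : ℕ → V} {n m : ℕ} {X Y : Set V}
    {x a b x' a' b' : V} (hXY : G.Anticomplete X Y)
    (hX : G.Anticomplete X {x, b}) (hX' : G.Anticomplete X {x', b'})
    (hY : G.Anticomplete Y {x, a}) (hY' : G.Anticomplete Y {x', a'})
    (hfar : G.Anticomplete {x, a, b} {x', a', b'})
    (hxa : G.Adj x a) (hxb : G.Adj x b) (hxa' : G.Adj x' a') (hxb' : G.Adj x' b')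
    (hab : a ≠ b) (hab' : a' ≠ b')
    (hp : G.IsIndPath p n) (hq : G.IsIndPath q m) (hn : 2 ≤ n) (hm : 2 ≤ m)
    (hp0 : p 0 = a) (hp1 : p n = a') (hq0 : q 0 = b) (hq1 : q m = b')
    (hpX : ∀ i, 0 < i → i < n → p i ∈ X) (hqY : ∀ i, 0 < i → i < m → q i ∈ Y) :
    Odd (n + m + (if G.Adj a b then 1 else 0) + (if G.Adj a' b' then 1 else 0)) := by
  have hpz : ∀ z, z = x' ∨ z = b' → ∀ i < n, p i ≠ z ∧ ¬ G.Adj (p i) z := by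
    intro z hz i hi
    rcases Nat.eq_zero_or_pos i with rfl | hi0
    · rw [hp0]
      exact hfar a (by simp) z (by rcases hz with rfl | rfl <;> simp)
    · exact hX' _ (hpX i hi0 hi) z hz
  have hqz : ∀ z, z = x ∨ z = a → ∀ j < m, q (m - j) ≠ z ∧ ¬ G.Adj (q (m - j)) z := by
    intro z hz j hj
    rcases Nat.eq_zero_or_pos j with rfl | hj0
    · rw [Nat.sub_zero, hq1]
      exact hfar.symm b' (by simp) z (by rcases hz with rfl | rfl <;> simp)
    · exact hY _ (hqY (m - j) (by omega) (by omega)) z hz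
  obtain ⟨P, k, hk, hP, hPb, hPp, hPx⟩ := hp.exists_extend (hpz b' (.inr rfl))
    (hpz x' (.inl rfl)) (by rwa [hp1]) (by rw [hp1]; exact hxa'.symm) hxb'
  obtain ⟨Q, l, hl, hQ, hQa, hQq, hQx⟩ := hq.reverse.exists_extend (hqz a (.inr rfl))
    (hqz x (.inl rfl)) (by simpa [hq0] using hab.symm) (by simpa [hq0] using hxb.symm) hxa
  rw [hp1] at hk
  simp only [Nat.sub_self, hq0, G.adj_comm b a] at hl
  have hP0 : P 0 = a := by rw [hPp 0 (by omega), hp0]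
  have hQ0 : Q 0 = b' := by rw [hQq 0 (by omega), Nat.sub_zero, hq1]
  have hPcase : ∀ i, 0 < i → i ≤ k → P i ∈ X ∨ P i ∈ ({x', a'} : Set V) := by
    intro i hi0 hi
    rcases lt_trichotomy i n with h | rfl | h
    · exact .inl (hPp i h.le ▸ hpX i hi0 h)
    · exact .inr (by simp [hPp i le_rfl, hp1])
    · exact .inr (by simp [hPx i h])
  have hQcase : ∀ j, 0 < j → j ≤ l → Q j ∈ Y ∨ Q j ∈ ({x, b} : Set V) := by
    intro j hj0 hj
    rcases lt_trichotomy j m with h | rfl | h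
    · exact .inl (hQq j h.le ▸ hqY (m - j) (by omega) (by omega))
    · exact .inr (by simp [hQq j le_rfl, hq0])
    · exact .inr (by simp [hQx j h])
  have key : Odd (k + l) := by
    refine hG.odd_of_isIndPath hP hQ (by omega) fun i hi j hj => ?_
    rcases Nat.eq_zero_or_pos j with rfl | hj0
    · rw [hQ0]
      exact ⟨(hPb i hi).1, (hPb i hi).2.trans (by omega)⟩
    rcases Nat.eq_zero_or_pos i with rfl | hi0
    · rw [hP0, G.adj_comm]
      exact ⟨(hQa j hj).1.symm, (hQa j hj).2.trans (by omega)⟩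
    suffices h : P i ≠ Q j ∧ ¬ G.Adj (P i) (Q j) from ⟨h.1, iff_of_false h.2 (by omega)⟩
    rcases hPcase i hi0 hi with h1 | h1 <;> rcases hQcase j hj0 hj with h2 | h2
    · exact hXY _ h1 _ h2
    · exact hX _ h1 _ h2
    · exact hY'.symm _ h1 _ h2
    · refine hfar.symm _ ?_ _ ?_
      · rcases h1 with h1 | h1 <;> rw [h1] <;> simp
      · rcases h2 with h2 | h2 <;> rw [h2] <;> simp
  rw [Nat.odd_iff] at key ⊢
  split_ifs <;> simp_all <;> omega

end Holes

section Ports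

/-- `x` is attached to three sets through the pairwise distinct neighbours `a`, `b`, `c`, each of
which sees only its own set. -/
structure IsPort (G : SimpleGraph V) (X Y Z : Set V) (x a b c : V) : Prop where
  adj_a : G.Adj x a
  adj_b : G.Adj x b
  adj_c : G.Adj x c
  ne_ab : a ≠ b
  ne_ac : a ≠ c
  ne_bc : b ≠ c
  exists_a : ∃ u ∈ X, G.Adj a u
  exists_b : ∃ u ∈ Y, G.Adj b u
  exists_c : ∃ u ∈ Z, G.Adj c u
  anti_X : G.Anticomplete X {x, b, c}
  anti_Y : G.Anticomplete Y {x, a, c}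
  anti_Z : G.Anticomplete Z {x, a, b}

open Classical in
lemma EvenHoleFree.odd_of_isPort (hG : G.EvenHoleFree) {X Y Z : Set V}
    (hXY : G.Anticomplete X Y) (hXZ : G.Anticomplete X Z) (hYZ : G.Anticomplete Y Z)
    (hX : G.ConnOn X) (hY : G.ConnOn Y) (hZ : G.ConnOn Z) {x a b c x' a' b' c' : V}
    (h : G.IsPort X Y Z x a b c) (h' : G.IsPort X Y Z x' a' b' c')
    (hfar : G.Anticomplete {x, a, b, c} {x', a', b', c'}) :
    Odd ((if G.Adj a b then 1 else 0) + (if G.Adj a c then 1 else 0) +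
        (if G.Adj b c then 1 else 0) + ((if G.Adj a' b' then 1 else 0) +
        (if G.Adj a' c' then 1 else 0) + (if G.Adj b' c' then 1 else 0))) := by
  have haa := hfar a (by simp) a' (by simp)
  have hbb := hfar b (by simp) b' (by simp)
  have hcc := hfar c (by simp) c' (by simp)
  obtain ⟨p, n, hn, hp, hp0, hp1, hpX⟩ := hX.exists_isIndPath haa.1 haa.2 h.exists_a h'.exists_a
  obtain ⟨q, m, hm, hq, hq0, hq1, hqY⟩ := hY.exists_isIndPath hbb.1 hbb.2 h.exists_b h'.exists_b
  obtain ⟨r, k, hk, hr, hr0, hr1, hrZ⟩ := hZ.exists_isIndPath hcc.1 hcc.2 h.exists_c h'.exists_c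
  have sub1 : ∀ s t u : V, ({s, t} : Set V) ⊆ {s, t, u} := by
    intro s t u v hv
    rcases hv with rfl | rfl <;> simp
  have sub2 : ∀ s t u : V, ({s, u} : Set V) ⊆ {s, t, u} := by
    intro s t u v hv
    rcases hv with rfl | rfl <;> simp
  have sub3 : ∀ s t u w : V, ({s, t, u} : Set V) ⊆ {s, t, u, w} := by
    intro s t u w v hv
    rcases hv with rfl | rfl | rfl <;> simp
  have sub4 : ∀ s t u w : V, ({s, t, w} : Set V) ⊆ {s, t, u, w} := by
    intro s t u w v hv
    rcases hv with rfl | rfl | rfl <;> simp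
  have sub5 : ∀ s t u w : V, ({s, u, w} : Set V) ⊆ {s, t, u, w} := by
    intro s t u w v hv
    rcases hv with rfl | rfl | rfl <;> simp
  have le := fun (S : Set V) => subset_refl S
  have e1 := hG.odd_of_linked hXY (h.anti_X.mono (le _) (sub1 _ _ _))
    (h'.anti_X.mono (le _) (sub1 _ _ _)) (h.anti_Y.mono (le _) (sub1 _ _ _))
    (h'.anti_Y.mono (le _) (sub1 _ _ _)) (hfar.mono (sub3 _ _ _ _) (sub3 _ _ _ _))
    h.adj_a h.adj_b h'.adj_a h'.adj_b h.ne_ab h'.ne_ab hp hq hn hm hp0 hp1 hq0 hq1 hpX hqY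
  have e2 := hG.odd_of_linked hXZ (h.anti_X.mono (le _) (sub2 _ _ _))
    (h'.anti_X.mono (le _) (sub2 _ _ _)) (h.anti_Z.mono (le _) (sub1 _ _ _))
    (h'.anti_Z.mono (le _) (sub1 _ _ _)) (hfar.mono (sub4 _ _ _ _) (sub4 _ _ _ _))
    h.adj_a h.adj_c h'.adj_a h'.adj_c h.ne_ac h'.ne_ac hp hr hn hk hp0 hp1 hr0 hr1 hpX hrZ
  have e3 := hG.odd_of_linked hYZ (h.anti_Y.mono (le _) (sub2 _ _ _))
    (h'.anti_Y.mono (le _) (sub2 _ _ _)) (h.anti_Z.mono (le _) (sub2 _ _ _))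
    (h'.anti_Z.mono (le _) (sub2 _ _ _)) (hfar.mono (sub5 _ _ _ _) (sub5 _ _ _ _))
    h.adj_b h.adj_c h'.adj_b h'.adj_c h.ne_bc h'.ne_bc hq hr hm hk hq0 hq1 hr0 hr1 hqY hrZ
  rw [Nat.odd_iff] at e1 e2 e3 ⊢
  omega

/-- There are no three pairwise distant ports. -/
lemma EvenHoleFree.false_of_three_isPort (hG : G.EvenHoleFree) {X Y Z : Set V}
    (hXY : G.Anticomplete X Y) (hXZ : G.Anticomplete X Z) (hYZ : G.Anticomplete Y Z)
    (hX : G.ConnOn X) (hY : G.ConnOn Y) (hZ : G.ConnOn Z)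
    {x₁ a₁ b₁ c₁ x₂ a₂ b₂ c₂ x₃ a₃ b₃ c₃ : V}
    (h₁ : G.IsPort X Y Z x₁ a₁ b₁ c₁) (h₂ : G.IsPort X Y Z x₂ a₂ b₂ c₂)
    (h₃ : G.IsPort X Y Z x₃ a₃ b₃ c₃)
    (h₁₂ : G.Anticomplete {x₁, a₁, b₁, c₁} {x₂, a₂, b₂, c₂})
    (h₁₃ : G.Anticomplete {x₁, a₁, b₁, c₁} {x₃, a₃, b₃, c₃})
    (h₂₃ : G.Anticomplete {x₂, a₂, b₂, c₂} {x₃, a₃, b₃, c₃}) : False := by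
  classical
  have e1 := hG.odd_of_isPort hXY hXZ hYZ hX hY hZ h₁ h₂ h₁₂
  have e2 := hG.odd_of_isPort hXY hXZ hYZ hX hY hZ h₁ h₃ h₁₃
  have e3 := hG.odd_of_isPort hXY hXZ hYZ hX hY hZ h₂ h₃ h₂₃
  rw [Nat.odd_iff] at e1 e2 e3
  omega

/-- A vertex far from the ball centres `L` has its whole closed neighbourhood far from `L`. -/
lemma anticomplete_of_notMem_ballTwo {S T : Set V} {x : V}
    (hS : ∀ s ∈ S, x ∉ G.ballTwo s) (hT : ∀ t ∈ T, x = t ∨ G.Adj t x) :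
    G.Anticomplete S T := fun s hs t ht =>
  ⟨fun h => hS s hs ⟨t, .inl h.symm, hT t ht⟩, fun h => hS s hs ⟨t, .inr h, hT t ht⟩⟩

lemma IsPort.eq_or_adj {X Y Z : Set V} {x a b c : V} (h : G.IsPort X Y Z x a b c) :
    ∀ t ∈ ({x, a, b, c} : Set V), x = t ∨ G.Adj t x := by
  rintro t (rfl | rfl | rfl | rfl)
  · exact .inl rfl
  · exact .inr h.adj_a.symm
  · exact .inr h.adj_b.symm
  · exact .inr h.adj_c.symm

/-- The dominating vertices of `D` that are attached to both `U` and `W` lie close together. -/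
lemma EvenHoleFree.exists_forall_notMem_ballTwo (hG : G.EvenHoleFree) {U W B D : Set V}
    (hUW : G.Anticomplete U W) (hUD : G.Anticomplete U D) (hWD : G.Anticomplete W D)
    (hU : G.ConnOn U) (hW : G.ConnOn W) (hD : G.ConnOn D) (hBU : ∀ b ∈ B, ∃ u ∈ U, G.Adj b u)
    (hne : D.Nonempty) :
    ∃ k, ∀ x ∈ D, x ∉ G.ballTwo k → ∀ b ∈ B, G.Adj x b → ∀ w ∈ W, ¬ G.Adj w b := by
  by_cases hK : ∃ k ∈ B, (∃ w ∈ W, G.Adj k w) ∧ ∃ x ∈ D, G.Adj k x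
  · obtain ⟨k, hkB, hkW, hkD⟩ := hK
    refine ⟨k, fun x hx hxk b hb hxb w hw hwb => hxk ?_⟩
    have := hG.eq_or_adj_of_three hUW hUD hWD hU hW hD (hBU k hkB) hkW hkD (hBU b hb)
      ⟨w, hw, hwb.symm⟩ ⟨x, hx, hxb.symm⟩
    exact ⟨b, this.imp Eq.symm id, .inr hxb.symm⟩
  · obtain ⟨k, _⟩ := hne
    exact ⟨k, fun x hx _ b hb hxb w hw hwb =>
      hK ⟨b, hb, ⟨w, hw, hwb.symm⟩, x, hx, hxb.symm⟩⟩

lemma EvenHoleFree.colorableOn_univ_of_ballTwo (hG : G.EvenHoleFree) {τ : ℕ}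
    (hτ : ∀ v, G.ColorableOn (G.ballTwo v) τ) :
    G.ColorableOn Set.univ (2 * (2 * (2 * (11 * τ)))) := by
  by_contra h₀
  have hball : ∀ n, τ ≤ n → ∀ v, G.ColorableOn (G.ballTwo v) n := fun n hn v =>
    (hτ v).mono subset_rfl hn
  obtain ⟨U₁, B₁, D₁, -, -, -, hU₁, -, hn₁, hUD₁, hBD₁, hB₁, hBU₁⟩ :=
    exists_layering (hball _ (by omega)) h₀
  obtain ⟨U₂, B₂, D₂, hUS₂, hBS₂, hDS₂, hU₂, -, hn₂, hUD₂, hBD₂, hB₂, hBU₂⟩ :=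
    exists_layering (hball _ (by omega)) hn₁
  obtain ⟨U₃, B₃, D₃, hUS₃, hBS₃, hDS₃, hU₃, hD₃, hn₃, hUD₃, hBD₃, hB₃, hBU₃⟩ :=
    exists_layering (hball _ (by omega)) hn₂
  have h₁₂ : G.Anticomplete U₁ U₂ := hUD₁.mono subset_rfl hUS₂
  have h₁₃ : G.Anticomplete U₁ U₃ := hUD₁.mono subset_rfl (hUS₃.trans hDS₂)
  have h₂₃ : G.Anticomplete U₂ U₃ := hUD₂.mono subset_rfl hUS₃
  have hUD₁' : G.Anticomplete U₁ D₃ := hUD₁.mono subset_rfl (hDS₃.trans hDS₂)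
  have hUD₂' : G.Anticomplete U₂ D₃ := hUD₂.mono subset_rfl hDS₃
  have hne : D₃.Nonempty := by
    rw [Set.nonempty_iff_ne_empty]
    rintro rfl
    exact hn₃ ⟨fun _ => 0, by simp, by simp⟩
  obtain ⟨k₁₂, hk₁₂⟩ :=
    hG.exists_forall_notMem_ballTwo h₁₂ hUD₁' hUD₂' hU₁ hU₂ hD₃ hBU₁ hne
  obtain ⟨k₁₃, hk₁₃⟩ :=
    hG.exists_forall_notMem_ballTwo h₁₃ hUD₁' hUD₃ hU₁ hU₃ hD₃ hBU₁ hne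
  obtain ⟨k₂₃, hk₂₃⟩ :=
    hG.exists_forall_notMem_ballTwo h₂₃ hUD₂' hUD₃ hU₂ hU₃ hD₃ hBU₂ hne
  have hport : ∀ x ∈ D₃, x ∉ G.ballTwo k₁₂ → x ∉ G.ballTwo k₁₃ → x ∉ G.ballTwo k₂₃ →
      ∃ a b c, G.IsPort U₁ U₂ U₃ x a b c := by
    intro x hx hx₁₂ hx₁₃ hx₂₃
    have hx₂ := hDS₃ hx
    have hx₁ := hDS₂ hx₂
    obtain ⟨a, ha, hxa⟩ := hB₁ x hx₁
    obtain ⟨b, hb, hxb⟩ := hB₂ x hx₂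
    obtain ⟨c, hc, hxc⟩ := hB₃ x hx
    have hb₁ := hBS₂ hb
    have hc₂ := hBS₃ hc
    have hc₁ := hDS₂ hc₂
    have ha₁ := Set.disjoint_left.1 hBD₁ ha
    have hb₂ := Set.disjoint_left.1 hBD₂ hb
    refine ⟨a, b, c, hxa, hxb, hxc, ?_, ?_, ?_, hBU₁ a ha, hBU₂ b hb, hBU₃ c hc, ?_, ?_, ?_⟩
    · rintro rfl
      exact ha₁ hb₁
    · rintro rfl
      exact ha₁ hc₁
    · rintro rfl
      exact hb₂ hc₂
    · rintro u hu v (rfl | rfl | rfl)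
      · exact hUD₁ u hu _ hx₁
      · exact hUD₁ u hu _ hb₁
      · exact hUD₁ u hu _ hc₁
    · rintro u hu v (rfl | rfl | rfl)
      · exact hUD₂ u hu _ hx₂
      · refine ⟨?_, hk₁₂ x hx hx₁₂ _ ha hxa u hu⟩
        rintro rfl
        exact ha₁ (hUS₂ hu)
      · exact hUD₂ u hu _ hc₂
    · rintro u hu v (rfl | rfl | rfl)
      · exact hUD₃ u hu _ hx
      · refine ⟨?_, hk₁₃ x hx hx₁₃ _ ha hxa u hu⟩
        rintro rfl
        exact ha₁ (hDS₂ (hUS₃ hu))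
      · refine ⟨?_, hk₂₃ x hx hx₂₃ _ hb hxb u hu⟩
        rintro rfl
        exact hb₂ (hUS₃ hu)
  obtain ⟨x₁, hx₁, hL₁⟩ := exists_mem_forall_notMem_of_not_colorableOn hτ
    [k₁₂, k₁₃, k₂₃] (by simp) hn₃
  simp only [List.forall_mem_cons] at hL₁
  obtain ⟨a₁, b₁, c₁, hp₁⟩ := hport x₁ hx₁ hL₁.1 hL₁.2.1 hL₁.2.2.1
  obtain ⟨x₂, hx₂, hL₂⟩ := exists_mem_forall_notMem_of_not_colorableOn hτ
    [k₁₂, k₁₃, k₂₃, x₁, a₁, b₁, c₁] (by simp) hn₃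
  have hL₂' := hL₂
  simp only [List.forall_mem_cons] at hL₂'
  obtain ⟨a₂, b₂, c₂, hp₂⟩ := hport x₂ hx₂ hL₂'.1 hL₂'.2.1 hL₂'.2.2.1
  obtain ⟨x₃, hx₃, hL₃⟩ := exists_mem_forall_notMem_of_not_colorableOn hτ
    [k₁₂, k₁₃, k₂₃, x₁, a₁, b₁, c₁, x₂, a₂, b₂, c₂] (by simp) hn₃
  have hL₃' := hL₃
  simp only [List.forall_mem_cons] at hL₃'
  obtain ⟨a₃, b₃, c₃, hp₃⟩ := hport x₃ hx₃ hL₃'.1 hL₃'.2.1 hL₃'.2.2.1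
  refine hG.false_of_three_isPort h₁₂ h₁₃ h₂₃ hU₁ hU₂ hU₃ hp₁ hp₂ hp₃
    (anticomplete_of_notMem_ballTwo (fun s hs => hL₂ s ?_) hp₂.eq_or_adj)
    (anticomplete_of_notMem_ballTwo (fun s hs => hL₃ s ?_) hp₃.eq_or_adj)
    (anticomplete_of_notMem_ballTwo (fun s hs => hL₃ s ?_) hp₃.eq_or_adj)
  all_goals rcases hs with rfl | rfl | rfl | rfl <;> simp

end Ports

section Local

lemma EvenHoleFree.false_of_four_cycle (hG : G.EvenHoleFree) {a b c d : V} (hab : G.Adj a b)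
    (hbc : G.Adj b c) (hcd : G.Adj c d) (hda : G.Adj d a) (hac : a ≠ c) (hac' : ¬ G.Adj a c)
    (hbd : b ≠ d) (hbd' : ¬ G.Adj b d) : False := by
  have h := hG (fun i => match i with | 0 => a | 1 => b | 2 => c | _ => d) 4 le_rfl ?_
  · exact absurd h (by decide)
  · intro i j hij hj
    have := hab.ne
    have := hbc.ne
    have := hcd.ne
    have := hda.ne'
    have := hda.symm
    interval_cases j <;> interval_cases i <;> simp_all

lemma EvenHoleFree.false_of_six_cycle (hG : G.EvenHoleFree) {a b c d e f : V} (hab : G.Adj a b)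
    (hbc : G.Adj b c) (hcd : G.Adj c d) (hde : G.Adj d e) (hef : G.Adj e f) (hfa : G.Adj f a)
    (hac : a ≠ c ∧ ¬ G.Adj a c) (had : a ≠ d ∧ ¬ G.Adj a d) (hae : a ≠ e ∧ ¬ G.Adj a e)
    (hbd : b ≠ d ∧ ¬ G.Adj b d) (hbe : b ≠ e ∧ ¬ G.Adj b e) (hbf : b ≠ f ∧ ¬ G.Adj b f)
    (hce : c ≠ e ∧ ¬ G.Adj c e) (hcf : c ≠ f ∧ ¬ G.Adj c f) (hdf : d ≠ f ∧ ¬ G.Adj d f) :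
    False := by
  have h := hG (fun i => match i with
    | 0 => a | 1 => b | 2 => c | 3 => d | 4 => e | _ => f) 6 (by decide) ?_
  · exact absurd h (by decide)
  · intro i j hij hj
    have := hab.ne
    have := hbc.ne
    have := hcd.ne
    have := hde.ne
    have := hef.ne
    have := hfa.ne'
    have := hfa.symm
    interval_cases j <;> interval_cases i <;> simp_all

/-- A set on which adjacency is transitive is a disjoint union of cliques. -/
lemma colorableOn_of_adj_trans {c : ℕ} (hc : ∀ v, G.ColorableOn (G.neighborSet v) c) {W : Set V}
    (hW : ∀ u ∈ W, ∀ v ∈ W, ∀ w ∈ W, G.Adj u v → G.Adj v w → u ≠ w → G.Adj u w) :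
    G.ColorableOn W (1 + c) := by
  refine ColorableOn.glue (fun v => {u | u ∈ W ∧ (u = v ∨ G.Adj u v)}) ?_ fun C => ?_
  · have key : ∀ u ∈ W, ∀ v ∈ W, G.Adj u v →
        {w | w ∈ W ∧ (w = u ∨ G.Adj w u)} ⊆ {w | w ∈ W ∧ (w = v ∨ G.Adj w v)} := by
      rintro u hu v hv huv w ⟨hw, rfl | hwu⟩
      · exact ⟨hw, .inr huv⟩
      · by_cases hwv : w = v
        · exact ⟨hw, .inl hwv⟩
        · exact ⟨hw, .inr (hW w hw u hu v hv hwu huv hwv)⟩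
    exact fun u hu v hv huv => (key u hu v hv huv).antisymm (key v hv u hu huv.symm)
  · rcases Set.eq_empty_or_nonempty
      {v | v ∈ W ∧ {u | u ∈ W ∧ (u = v ∨ G.Adj u v)} = C} with h | ⟨w, hw, hwC⟩
    · rw [h]
      exact ⟨fun _ => 0, by simp, by simp⟩
    · have h1 : G.ColorableOn {w} 1 := colorableOn_of_forall_not_adj (by simp)
      refine (h1.union (hc w)).mono ?_ le_rfl
      rintro v ⟨hv, hvC⟩
      have : v ∈ {u | u ∈ W ∧ (u = v ∨ G.Adj u v)} := ⟨hv, .inl rfl⟩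
      rw [hvC, ← hwC] at this
      exact this.2.imp id fun h => h.symm

lemma EvenHoleFree.colorableOn_ballTwo (hG : G.EvenHoleFree) {c : ℕ}
    (hc : ∀ v, G.ColorableOn (G.neighborSet v) c) (v : V) :
    G.ColorableOn (G.ballTwo v) (1 + c + c * (c * (1 + c))) := by
  have h1 : G.ColorableOn {v} 1 := colorableOn_of_forall_not_adj (by simp)
  let N : Set V := {y | y ≠ v ∧ ¬ G.Adj v y ∧ ∃ a, G.Adj v a ∧ G.Adj a y}
  suffices hN : G.ColorableOn N (c * (c * (1 + c))) by
    refine ((h1.union (hc v)).union hN).mono ?_ le_rfl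
    rintro y ⟨z, hz, hy⟩
    by_cases hyv : y = v
    · exact .inl (.inl hyv)
    by_cases hvy : G.Adj v y
    · exact .inl (.inr hvy)
    rcases hz with rfl | hz <;> rcases hy with rfl | hy
    · exact (hyv rfl).elim
    · exact (hvy hy).elim
    · exact (hvy hz).elim
    · exact .inr ⟨hyv, hvy, z, hz, hy⟩
  have hπ : ∀ y, ∃ a, y ∈ N → G.Adj v a ∧ G.Adj a y := by
    intro y
    by_cases hy : y ∈ N
    · obtain ⟨a, ha⟩ := hy.2.2
      exact ⟨a, fun _ => ha⟩
    · exact ⟨v, fun h => (hy h).elim⟩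
  choose π hπ using hπ
  obtain ⟨f, hf, hf'⟩ := hc v
  choose g hg hg' using hc
  refine ColorableOn.mul (fun y => f (π y)) (fun y hy => hf _ (hπ y hy).1) fun i => ?_
  refine ColorableOn.mul (fun y => g (π y) y) (fun y hy => hg _ _ (hπ y hy.1).2) fun j => ?_
  have hnot : ∀ u, u ∈ N → ∀ w, w ∈ N → f (π u) = i → f (π w) = i → ¬ G.Adj (π u) (π w) :=
    fun u hu w hw hui hwi h => hf' _ (hπ u hu).1 _ (hπ w hw).1 h (hui.trans hwi.symm)
  have hcross : ∀ u, u ∈ N → ∀ w, w ∈ N → f (π u) = i → f (π w) = i → π u ≠ π w →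
      ¬ G.Adj u (π w) := fun u hu w hw hui hwi hne h =>
    hG.false_of_four_cycle (hπ u hu).1 (hπ u hu).2 h (hπ w hw).1.symm hu.1.symm hu.2.1 hne
      (hnot u hu w hw hui hwi)
  refine colorableOn_of_adj_trans (fun v => ⟨g v, hg v, hg' v⟩) ?_
  rintro u ⟨⟨hu, hui⟩, huj⟩ w ⟨⟨hw, hwi⟩, hwj⟩ x ⟨⟨hx, hxi⟩, hxj⟩ huw hwx hux
  have hne : ∀ s ∈ N, ∀ t ∈ N, g (π s) s = j → g (π t) t = j → G.Adj s t → π s ≠ π t := by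
    intro s hs t ht hsj htj hst h
    refine hg' (π t) s (h ▸ (hπ s hs).2) t (hπ t ht).2 hst ?_
    rw [htj, ← hsj, h]
  have huw' := hne u hu w hw huj hwj huw
  have hwx' := hne w hw x hx hwj hxj hwx
  by_contra hux'
  have hnm : ∀ s ∈ N, ∀ t ∈ N, π s ≠ t := by
    rintro s hs t ht rfl
    exact ht.2.1 (hπ s hs).1
  by_cases h : π u = π x
  · refine hG.false_of_four_cycle (hπ u hu).2 huw hwx (h ▸ (hπ x hx).2.symm) (hnm u hu w hw) ?_
      hux hux'
    rw [G.adj_comm]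
    exact hcross w hw u hu hwi hui huw'.symm
  · exact hG.false_of_six_cycle (hπ u hu).1 (hπ u hu).2 huw hwx (hπ x hx).2.symm
      (hπ x hx).1.symm ⟨hu.1.symm, hu.2.1⟩ ⟨hw.1.symm, hw.2.1⟩ ⟨hx.1.symm, hx.2.1⟩
      ⟨hnm u hu w hw, fun h' => hcross w hw u hu hwi hui huw'.symm h'.symm⟩
      ⟨hnm u hu x hx, fun h' => hcross x hx u hu hxi hui (Ne.symm h) h'.symm⟩
      ⟨h, hnot u hu x hx hui hxi⟩ ⟨hux, hux'⟩
      ⟨(hnm x hx u hu).symm, hcross u hu x hx hui hxi h⟩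
      ⟨(hnm x hx w hw).symm, hcross w hw x hx hwi hxi hwx'⟩

end Local

section ChiBounded

/-- A `χ`-binding function for even-hole-free graphs. -/
def evenHoleFreeBound : ℕ → ℕ
  | 0 => 0
  | k + 1 => 2 * (2 * (2 * (11 * (1 + evenHoleFreeBound k +
      evenHoleFreeBound k * (evenHoleFreeBound k * (1 + evenHoleFreeBound k))))))

lemma EvenHoleFree.induce (hG : G.EvenHoleFree) (S : Set V) : (G.induce S).EvenHoleFree :=
  fun c l hl hc => hG (fun i => c i) l hl fun i j hij hj =>
    ⟨fun h => (hc i j hij hj).1 (Subtype.ext h), (hc i j hij hj).2⟩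

lemma ColorableOn.of_induce {S : Set V} {n : ℕ} (h : (G.induce S).ColorableOn Set.univ n) :
    G.ColorableOn S n := by
  classical
  obtain ⟨f, hf, hf'⟩ := h
  refine ⟨fun v => if hv : v ∈ S then f ⟨v, hv⟩ else 0, fun v hv => ?_, fun u hu v hv huv => ?_⟩
  · simpa [hv] using hf ⟨v, hv⟩ trivial
  · simpa [hu, hv] using hf' ⟨u, hu⟩ trivial ⟨v, hv⟩ trivial huv

lemma EvenHoleFree.colorableOn_univ (k : ℕ) {V : Type*} {G : SimpleGraph V}
    (hG : G.EvenHoleFree) (hk : ∀ t : Finset V, G.IsClique t → t.card ≤ k) :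
    G.ColorableOn Set.univ (evenHoleFreeBound k) := by
  classical
  induction k generalizing V with
  | zero =>
    have : IsEmpty V := ⟨fun v => by simpa using hk {v} (by simp)⟩
    exact ⟨fun _ => 0, fun v => this.elim v, fun v => this.elim v⟩
  | succ k ih =>
    refine hG.colorableOn_univ_of_ballTwo (hG.colorableOn_ballTwo fun v => ?_)
    refine ColorableOn.of_induce (ih (hG.induce _) fun t ht => ?_)
    have hv : v ∉ t.map (Function.Embedding.subtype _) := by
      simp
    have := hk (insert v (t.map (Function.Embedding.subtype _))) ?_
    · rw [Finset.card_insert_of_notMem hv, Finset.card_map] at this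
      omega
    · rw [Finset.coe_insert, isClique_insert]
      refine ⟨?_, fun b hb _ => ?_⟩
      · rw [Finset.coe_map]
        rintro _ ⟨x, hx, rfl⟩ _ ⟨y, hy, rfl⟩ hxy
        exact ht hx hy fun h => hxy (h ▸ rfl)
      · simp only [Finset.coe_map, Set.mem_image, Function.Embedding.subtype_apply] at hb
        obtain ⟨x, -, rfl⟩ := hb
        exact x.2

lemma ColorableOn.colorable {n : ℕ} (h : G.ColorableOn Set.univ n) : G.Colorable n := by
  obtain ⟨f, hf, hf'⟩ := h
  exact ⟨Coloring.mk (fun v => ⟨f v, hf v trivial⟩) fun {u v} huv e =>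
    hf' u trivial v trivial huv (congrArg Fin.val e)⟩

end ChiBounded

section Cycles

lemma IsIndCycle.nonempty_iso {c : ℕ → V} {l : ℕ} (hc : G.IsIndCycle c l) :
    ∃ s : Set V, Nonempty (G.induce s ≃g cycleGraph l) := by
  have hadj : ∀ i j : Fin l, i < j → (G.Adj (c i) (c j) ↔ (cycleGraph l).Adj i j) := by
    intro i j hij
    have hij' : i.val < j.val := hij
    rw [(hc i j hij j.2).2, cycleGraph_adj', Fin.coe_sub_iff_lt.2 hij, Fin.coe_sub_iff_le.2 hij.le]
    omega
  have hinj : Function.Injective fun i : Fin l => c i := by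
    intro i j hij
    by_contra hne
    rcases lt_or_gt_of_ne hne with h | h
    · exact (hc i j h j.2).1 hij
    · exact (hc j i h i.2).1 hij.symm
  refine ⟨Set.range fun i : Fin l => c i, ⟨(RelIso.symm ⟨Equiv.ofInjective _ hinj, ?_⟩)⟩⟩
  intro i j
  change G.Adj (c i) (c j) ↔ _
  rcases lt_trichotomy i j with h | rfl | h
  · exact hadj i j h
  · simp
  · rw [G.adj_comm, (cycleGraph l).adj_comm]
    exact hadj j i h

/-- A shortest odd closed walk is an induced cycle. -/
lemma exists_odd_isIndCycle (h : ¬ G.Colorable 2) :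
    ∃ c l, 3 ≤ l ∧ Odd l ∧ G.IsIndCycle c l := by
  classical
  have hex : ∃ l, Odd l ∧ ∃ c : ℕ → V, c l = c 0 ∧ ∀ i < l, G.Adj (c i) (c (i + 1)) := by
    rw [two_colorable_iff_forall_loop_even] at h
    push Not at h
    obtain ⟨u, w, hw⟩ := h
    exact ⟨w.length, Nat.not_even_iff_odd.1 hw, w.getVert, by simp, fun i hi => w.adj_getVert_succ hi⟩
  obtain ⟨hodd, c, hc0, hc⟩ := Nat.find_spec hex
  have hmin := fun {m} => @Nat.find_min _ _ hex m
  generalize Nat.find hex = l at *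
  rw [Nat.odd_iff] at hodd
  have hl1 : l ≠ 1 := by
    rintro rfl
    have := hc 0 one_pos
    rw [hc0] at this
    exact this.ne rfl
  refine ⟨c, l, by omega, Nat.odd_iff.2 hodd, fun i j hij hj => ⟨fun heq => ?_, fun hadj => ?_, ?_⟩⟩
  · rcases Nat.mod_two_eq_zero_or_one (j - i) with h2 | h2
    · refine hmin (m := l - (j - i)) (by omega) ⟨Nat.odd_iff.2 (by omega),
        fun k => if k ≤ i then c k else c (k + (j - i)), ?_, fun k hk => ?_⟩
      · simpa [show ¬ l - (j - i) ≤ i by omega, show l - (j - i) + (j - i) = l by omega] using hc0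
      · rcases lt_trichotomy k i with h | rfl | h
        · simpa [h.le, Nat.succ_le_of_lt h] using hc k (by omega)
        · have := hc j (by omega)
          rw [← heq] at this
          simpa [show k + 1 + (j - k) = j + 1 by omega] using this
        · have := hc (k + (j - i)) (by omega)
          simpa [show ¬ k ≤ i by omega, show ¬ k + 1 ≤ i by omega, Nat.add_right_comm] using this
    · refine hmin (m := j - i) (by omega) ⟨Nat.odd_iff.2 h2, fun k => c (i + k), ?_, fun k hk => ?_⟩
      · simpa [show i + (j - i) = j by omega] using heq.symm
      · exact hc (i + k) (by omega)
  · by_contra! hne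
    rcases Nat.mod_two_eq_zero_or_one (j - i) with h2 | h2
    · refine hmin (m := j - i + 1) (by omega) ⟨Nat.odd_iff.2 (by omega),
        fun k => if k ≤ j - i then c (i + k) else c i, by simp, fun k hk => ?_⟩
      rcases (Nat.le_of_lt_succ hk).lt_or_eq with h | rfl
      · simpa [h.le, Nat.succ_le_of_lt h, Nat.add_assoc] using hc (i + k) (by omega)
      · simpa [show i + (j - i) = j by omega] using hadj.symm
    · refine hmin (m := l - (j - i - 1)) (by omega) ⟨Nat.odd_iff.2 (by omega),
        fun k => if k ≤ i then c k else c (k + (j - i - 1)), ?_, fun k hk => ?_⟩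
      · simpa [show ¬ l - (j - i - 1) ≤ i by omega,
          show l - (j - i - 1) + (j - i - 1) = l by omega] using hc0
      · rcases lt_trichotomy k i with h | rfl | h
        · simpa [h.le, Nat.succ_le_of_lt h] using hc k (by omega)
        · simpa [show k + 1 + (j - k - 1) = j by omega] using hadj
        · have := hc (k + (j - i - 1)) (by omega)
          simpa [show ¬ k ≤ i by omega, show ¬ k + 1 ≤ i by omega, Nat.add_right_comm] using this
  · rintro (rfl | ⟨rfl, rfl⟩)
    · exact hc i (by omega)
    · have := hc j (by omega)
      rw [hc0] at this
      exact this.symm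

end Cycles

end SimpleGraph

/-- The class of graphs in which any two induced cycles have the same parity is
`χ`-bounded. -/
theorem stmt_16 :
    ∃ f : ℕ → ℕ, ∀ (V : Type) [Fintype V] (G : SimpleGraph V),
      (∀ (ℓ₁ ℓ₂ : ℕ) (s₁ s₂ : Set V), 3 ≤ ℓ₁ → 3 ≤ ℓ₂ →
        Nonempty (G.induce s₁ ≃g cycleGraph ℓ₁) →
        Nonempty (G.induce s₂ ≃g cycleGraph ℓ₂) → (Even ℓ₁ ↔ Even ℓ₂)) →
      chi G ≤ f G.cliqueNum := by
  refine ⟨fun k => max 2 (evenHoleFreeBound k), fun V _ G hG => Nat.sInf_le ?_⟩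
  by_cases h : G.Colorable 2
  · exact h.mono (le_max_left _ _)
  · obtain ⟨c, l, hl, hodd, hc⟩ := exists_odd_isIndCycle h
    obtain ⟨s, hs⟩ := hc.nonempty_iso
    have hG' : G.EvenHoleFree := by
      intro c' l' hl' hc'
      obtain ⟨s', hs'⟩ := hc'.nonempty_iso
      rw [← Nat.not_even_iff_odd] at hodd ⊢
      exact fun he => hodd ((hG l l' s s' hl (by omega) hs hs').2 he)
    exact (hG'.colorableOn_univ _ fun t ht => ht.card_le_cliqueNum).colorable.mono
      (le_max_right _ _)
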